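/- Let k be a field of characteristic zero and I₂, I₄, I₆, I₁₀ ∈ k with I₁₀ ≠ 0. Define F(x,y,t) = y² − x³ + t³((I₄/12)t + 1)x − t⁵((I₁₀/4)t² + ((I₂I₄ − 3I₆)/108)t + I₂/24), and for t ≠ 0 define σ(x,y,t) = (16xw²/(I₁₀²t⁸), −64yw³/(I₁₀³t¹²), 4w/(I₁₀t³)) where w = −x + I₂t²/24. Then: (i) if t ≠ 0 and F(x,y,t) = 0, then F(σ(x,y,t)) = 0; and (ii) if moreover w ≠ 0, then σ(σ(x,y,t)) = (x,y,t). -/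

import Mathlib

/-- The defining polynomial of the elliptic K3 surface `X` of the main theorem:
`F(x,y,t) = y² - x³ + t³((I₄/12)t + 1)x - t⁵((I₁₀/4)t² + ((I₂I₄ - 3I₆)/108)t + I₂/24)`. -/
def surfaceEq {k : Type*} [Field k] (I₂ I₄ I₆ I₁₀ : k) (x y t : k) : k :=
  y ^ 2 - x ^ 3 + t ^ 3 * ((I₄ / 12) * t + 1) * x
    - t ^ 5 * ((I₁₀ / 4) * t ^ 2 + ((I₂ * I₄ - 3 * I₆) / 108) * t + I₂ / 24)

/-- The Nikulin involution on `X`: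
`(x, y, t) ↦ (16xw²/(I₁₀²t⁸), -64yw³/(I₁₀³t¹²), 4w/(I₁₀t³))` with `w = -x + I₂t²/24`. -/
def nikulinInvolution {k : Type*} [Field k] (I₂ I₁₀ : k) (p : k × k × k) : k × k × k :=
  (16 * p.1 * (-p.1 + I₂ * p.2.2 ^ 2 / 24) ^ 2 / (I₁₀ ^ 2 * p.2.2 ^ 8),
   -64 * p.2.1 * (-p.1 + I₂ * p.2.2 ^ 2 / 24) ^ 3 / (I₁₀ ^ 3 * p.2.2 ^ 12),
   4 * (-p.1 + I₂ * p.2.2 ^ 2 / 24) / (I₁₀ * p.2.2 ^ 3))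

/-- The defining polynomial of the surface is scaled by `(4w/(I₁₀t⁴))⁶` under the involution. -/
theorem surfaceEq_nikulinInvolution {k : Type*} [Field k] [CharZero k]
    (I₂ I₄ I₆ I₁₀ : k) (hI₁₀ : I₁₀ ≠ 0) (x y t : k) (ht : t ≠ 0) :
    surfaceEq I₂ I₄ I₆ I₁₀ (nikulinInvolution I₂ I₁₀ (x, y, t)).1
        (nikulinInvolution I₂ I₁₀ (x, y, t)).2.1
        (nikulinInvolution I₂ I₁₀ (x, y, t)).2.2 =
      (4 * (-x + I₂ * t ^ 2 / 24) / (I₁₀ * t ^ 4)) ^ 6 * surfaceEq I₂ I₄ I₆ I₁₀ x y t := by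
  obtain ⟨w, hw⟩ : ∃ w, w = -x + I₂ * t ^ 2 / 24 := ⟨_, rfl⟩
  obtain rfl : x = I₂ * t ^ 2 / 24 - w := by rw [hw]; ring
  simp only [surfaceEq, nikulinInvolution, ← hw]
  field_simp
  ring

/-- The involution is its own inverse where it is defined and `w ≠ 0`. -/
theorem nikulinInvolution_nikulinInvolution {k : Type*} [Field k] [CharZero k]
    (I₂ I₁₀ : k) (hI₁₀ : I₁₀ ≠ 0) (x y t : k) (ht : t ≠ 0)
    (hw : -x + I₂ * t ^ 2 / 24 ≠ 0) :
    nikulinInvolution I₂ I₁₀ (nikulinInvolution I₂ I₁₀ (x, y, t)) = (x, y, t) := by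
  obtain ⟨w, h⟩ : ∃ w, w = -x + I₂ * t ^ 2 / 24 := ⟨_, rfl⟩
  have hw' : -(16 * x * w ^ 2 / (I₁₀ ^ 2 * t ^ 8)) + I₂ * (4 * w / (I₁₀ * t ^ 3)) ^ 2 / 24 =
      16 * w ^ 3 / (I₁₀ ^ 2 * t ^ 8) := by
    obtain rfl : x = I₂ * t ^ 2 / 24 - w := by rw [h]; ring
    field_simp
    ring
  rw [← h] at hw
  simp only [nikulinInvolution, ← h, hw', Prod.mk.injEq]
  refine ⟨?_, ?_, ?_⟩ <;> field_simp <;> ring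

/-- The map `σ` of the main theorem is an involution of the surface `X`: it maps
points of `X` (with `t ≠ 0`) to points of `X`, and is its own inverse wherever
`w = -x + I₂t²/24 ≠ 0`. -/
theorem nikulin_involution_preserves_surface {k : Type*} [Field k] [CharZero k]
    (I₂ I₄ I₆ I₁₀ : k) (hI₁₀ : I₁₀ ≠ 0) (x y t : k) (ht : t ≠ 0)
    (hxyt : surfaceEq I₂ I₄ I₆ I₁₀ x y t = 0) :
    surfaceEq I₂ I₄ I₆ I₁₀ (nikulinInvolution I₂ I₁₀ (x, y, t)).1
        (nikulinInvolution I₂ I₁₀ (x, y, t)).2.1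
        (nikulinInvolution I₂ I₁₀ (x, y, t)).2.2 = 0 ∧
      (-x + I₂ * t ^ 2 / 24 ≠ 0 →
        nikulinInvolution I₂ I₁₀ (nikulinInvolution I₂ I₁₀ (x, y, t)) = (x, y, t)) := by
  refine ⟨?_, nikulinInvolution_nikulinInvolution I₂ I₁₀ hI₁₀ x y t ht⟩
  rw [surfaceEq_nikulinInvolution I₂ I₄ I₆ I₁₀ hI₁₀ x y t ht, hxyt, mul_zero]
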